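/- Assume γ > 0, the constants a, b, c satisfy (A1) or (A2), and ω > γ²/N². Set c₁ = √((b−c)/(b²−ac)) and c₂ = √((b−a)/(b²−ac)), and for every edge e define Φ₁,e(x) = c₁·φ_{ω,γ}(x) and Φ₂,e(x) = c₂·φ_{ω,γ}(x), where φ_{ω,γ}(x) = √(2ω)·sech(√ω·x + artanh(γ/(N√ω))). Then each component is smooth on [0,∞) and for all x > 0 satisfies −Φ₁,e″(x) + ω·Φ₁,e(x) − ( a·Φ₁,e(x)² + b·Φ₂,e(x)² )·Φ₁,e(x) = 0 and −Φ₂,e″(x) + ω·Φ₂,e(x) − ( b·Φ₁,e(x)² + c·Φ₂,e(x)² )·Φ₂,e(x) = 0, and the δ-vertex conditions ∑_{e=1}^N Φ₁,e′(0) = −γ·Φ₁,1(0) and ∑_{e=1}^N Φ₂,e′(0) = −γ·Φ₂,1(0) hold. In particular (e^{iωt}Φ₁, e^{iωt}Φ₂) is a standing-wave solution of the coupled cubic NLS system with δ coupling of strength γ at the vertex. -/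

import Mathlib

open MeasureTheory

noncomputable section

/-- The inverse hyperbolic tangent. -/
def artanh (x : ℝ) : ℝ := (1/2) * Real.log ((1+x)/(1-x))

/-- Assumption (A1): `0 < b < min {a, c}`. -/
def A1 (a b c : ℝ) : Prop := 0 < b ∧ b < min a c

/-- Assumption (A2): `a, c > 0` and `b > max {a, c}`. -/
def A2 (a b c : ℝ) : Prop := 0 < a ∧ 0 < c ∧ max a c < b

theorem artanh_eq_real_artanh {x : ℝ} (hx : x ∈ Set.Icc (-1) 1) : artanh x = Real.artanh x :=
  (Real.artanh_eq_half_log hx).symm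

theorem hasDerivAt_mul_inv_cosh (A s t x : ℝ) :
    HasDerivAt (fun x => A * (Real.cosh (s * x + t))⁻¹)
      (-(A * s) * (Real.sinh (s * x + t) * (Real.cosh (s * x + t) ^ 2)⁻¹)) x := by
  have hlin : HasDerivAt (fun x => s * x + t) s x := by
    simpa using ((hasDerivAt_id x).const_mul s).add_const t
  refine ((hlin.cosh.inv (Real.cosh_pos _).ne').const_mul A).congr_deriv ?_
  ring

theorem hasDerivAt_deriv_mul_inv_cosh (A s t x : ℝ) :
    HasDerivAt (deriv fun x => A * (Real.cosh (s * x + t))⁻¹)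
      (s ^ 2 * (A * ((Real.cosh (s * x + t))⁻¹ - 2 * (Real.cosh (s * x + t))⁻¹ ^ 3))) x := by
  have hlin : HasDerivAt (fun x => s * x + t) s x := by
    simpa using ((hasDerivAt_id x).const_mul s).add_const t
  have hc : Real.cosh (s * x + t) ≠ 0 := (Real.cosh_pos _).ne'
  rw [funext fun x => (hasDerivAt_mul_inv_cosh A s t x).deriv]
  refine ((hlin.sinh.mul ((hlin.cosh.pow 2).inv (pow_ne_zero 2 hc))).const_mul
    (-(A * s))).congr_deriv ?_
  have h := Real.cosh_sq (s * x + t)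
  simp only [Pi.pow_apply, Pi.inv_apply, Nat.cast_ofNat, Nat.add_one_sub_one, pow_one]
  field_simp
  linear_combination (-2 * A * s ^ 2) * h

theorem contDiff_mul_inv_cosh (A s t : ℝ) {n : WithTop ℕ∞} :
    ContDiff ℝ n fun x => A * (Real.cosh (s * x + t))⁻¹ :=
  contDiff_const.mul (((contDiff_const.mul contDiff_id).add contDiff_const).cosh.inv
    fun _ => (Real.cosh_pos _).ne')

/-- The soliton profile `κ √(2ω) sech(√ω x + t)` satisfies `f'' = ω f - 2ω sech² f`. -/
theorem deriv_deriv_sech_profile {ω : ℝ} (hω : 0 ≤ ω) (κ t x : ℝ) :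
    deriv (deriv fun x => κ * √(2 * ω) * (Real.cosh (√ω * x + t))⁻¹) x =
      κ * (ω * (√(2 * ω) * (Real.cosh (√ω * x + t))⁻¹)
        - (√(2 * ω) * (Real.cosh (√ω * x + t))⁻¹) ^ 3) := by
  rw [(hasDerivAt_deriv_mul_inv_cosh _ _ t x).deriv, Real.sq_sqrt hω]
  have h : √(2 * ω) ^ 2 = 2 * ω := Real.sq_sqrt (by positivity)
  linear_combination κ * √(2 * ω) * (Real.cosh (√ω * x + t))⁻¹ ^ 3 * h

theorem deriv_mul_inv_cosh_artanh_zero (A s : ℝ) {y : ℝ} (hy : y ∈ Set.Ioo (-1) 1) :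
    deriv (fun x => A * (Real.cosh (s * x + artanh y))⁻¹) 0 =
      -(s * y) * (A * (Real.cosh (s * 0 + artanh y))⁻¹) := by
  rw [(hasDerivAt_mul_inv_cosh A s _ 0).deriv]
  have h := Real.tanh_artanh hy
  rw [← artanh_eq_real_artanh (Set.Ioo_subset_Icc_self hy), Real.tanh_eq_sinh_div_cosh] at h
  have hc : Real.cosh (artanh y) ≠ 0 := (Real.cosh_pos _).ne'
  simp only [mul_zero, zero_add]
  rw [div_eq_iff hc] at h
  rw [h]
  field_simp

theorem coupling_coefficients_pos {a b c : ℝ} (h : A1 a b c ∨ A2 a b c) :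
    0 < (b - c) / (b ^ 2 - a * c) ∧ 0 < (b - a) / (b ^ 2 - a * c) := by
  rcases h with ⟨hb, h⟩ | ⟨ha, hc, h⟩
  · obtain ⟨h₁, h₂⟩ := lt_min_iff.mp h
    have hd : b ^ 2 - a * c < 0 := by nlinarith
    exact ⟨div_pos_of_neg_of_neg (by linarith) hd, div_pos_of_neg_of_neg (by linarith) hd⟩
  · obtain ⟨h₁, h₂⟩ := max_lt_iff.mp h
    have hd : 0 < b ^ 2 - a * c := by nlinarith
    exact ⟨div_pos (by linarith) hd, div_pos (by linarith) hd⟩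

/-- The explicit pair `(Φ₁, Φ₂) = (c₁·φ_{ω,γ}, c₂·φ_{ω,γ})` (the same on every
edge) is smooth on `[0,∞)`, solves the stationary coupled cubic NLS system on
every edge, and satisfies the δ-vertex conditions
`∑_{e=1}^N Φᵢ′(0) = −γ·Φᵢ(0)`; hence `(e^{iωt}Φ₁, e^{iωt}Φ₂)` is a
standing-wave solution of the coupled cubic NLS system on `Γ`. -/
theorem explicit_profile_solves_stationary_system (N : ℕ) (hN : 2 ≤ N)
    (γ a b c ω : ℝ) (hγ : 0 < γ) (hA : A1 a b c ∨ A2 a b c)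
    (hω : γ ^ 2 / (N : ℝ) ^ 2 < ω)
    (φ Φ₁ Φ₂ : ℝ → ℝ)
    (hφ : ∀ x, φ x = Real.sqrt (2 * ω) *
      (Real.cosh (Real.sqrt ω * x + artanh (γ / ((N : ℝ) * Real.sqrt ω))))⁻¹)
    (hΦ₁ : ∀ x, Φ₁ x = Real.sqrt ((b - c) / (b ^ 2 - a * c)) * φ x)
    (hΦ₂ : ∀ x, Φ₂ x = Real.sqrt ((b - a) / (b ^ 2 - a * c)) * φ x) :
    ContDiffOn ℝ (⊤ : ℕ∞) Φ₁ (Set.Ici (0:ℝ)) ∧ ContDiffOn ℝ (⊤ : ℕ∞) Φ₂ (Set.Ici (0:ℝ)) ∧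
    (∀ x : ℝ, 0 < x →
      -(deriv (deriv Φ₁) x) + ω * Φ₁ x
        - (a * (Φ₁ x) ^ 2 + b * (Φ₂ x) ^ 2) * Φ₁ x = 0) ∧
    (∀ x : ℝ, 0 < x →
      -(deriv (deriv Φ₂) x) + ω * Φ₂ x
        - (b * (Φ₁ x) ^ 2 + c * (Φ₂ x) ^ 2) * Φ₂ x = 0) ∧
    (∑ _e : Fin N, deriv Φ₁ 0) = -γ * Φ₁ 0 ∧
    (∑ _e : Fin N, deriv Φ₂ 0) = -γ * Φ₂ 0 := by
  obtain ⟨hp₁, hp₂⟩ := coupling_coefficients_pos hA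
  have hd : b ^ 2 - a * c ≠ 0 := fun h => by simp [h] at hp₁
  have hs₁ := Real.sq_sqrt hp₁.le
  have hs₂ := Real.sq_sqrt hp₂.le
  set c₁ := √((b - c) / (b ^ 2 - a * c))
  set c₂ := √((b - a) / (b ^ 2 - a * c))
  have hN0 : (0 : ℝ) < N := by positivity
  have hω0 : 0 < ω := lt_of_le_of_lt (by positivity) hω
  have hsω : 0 < √ω := Real.sqrt_pos.mpr hω0
  have hlt : γ / N < √ω := Real.lt_sqrt_of_sq_lt (by rwa [div_pow])
  have hy : γ / (N * √ω) ∈ Set.Ioo (-1) 1 := by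
    refine ⟨lt_trans (by norm_num) (show 0 < γ / (N * √ω) by positivity), ?_⟩
    rwa [← div_div, div_lt_one hsω]
  have hsum₁ : a * c₁ ^ 2 + b * c₂ ^ 2 = 1 := by
    rw [hs₁, hs₂, ← mul_div_assoc, ← mul_div_assoc, ← add_div, div_eq_one_iff_eq hd]
    ring
  have hsum₂ : b * c₁ ^ 2 + c * c₂ ^ 2 = 1 := by
    rw [hs₁, hs₂, ← mul_div_assoc, ← mul_div_assoc, ← add_div, div_eq_one_iff_eq hd]
    ring
  have profile_eq {κ : ℝ} {Φ : ℝ → ℝ} (h : ∀ x, Φ x = κ * φ x) :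
      Φ = fun x => κ * √(2 * ω) * (Real.cosh (√ω * x + artanh (γ / (N * √ω))))⁻¹ := by
    funext x
    rw [h, hφ, mul_assoc]
  have smooth {κ : ℝ} {Φ : ℝ → ℝ} (h : ∀ x, Φ x = κ * φ x) :
      ContDiffOn ℝ (⊤ : ℕ∞) Φ (Set.Ici 0) := by
    rw [profile_eq h]
    exact (contDiff_mul_inv_cosh _ _ _).contDiffOn
  have second_deriv {κ : ℝ} {Φ : ℝ → ℝ} (h : ∀ x, Φ x = κ * φ x) (x : ℝ) :
      deriv (deriv Φ) x = κ * (ω * φ x - φ x ^ 3) := by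
    rw [profile_eq h, deriv_deriv_sech_profile hω0.le, hφ]
  have vertex {κ : ℝ} {Φ : ℝ → ℝ} (h : ∀ x, Φ x = κ * φ x) :
      (∑ _e : Fin N, deriv Φ 0) = -γ * Φ 0 := by
    rw [profile_eq h, deriv_mul_inv_cosh_artanh_zero _ _ hy]
    simp only [Finset.sum_const, Finset.card_univ, Fintype.card_fin, nsmul_eq_mul]
    field_simp
  refine ⟨smooth hΦ₁, smooth hΦ₂, fun x _ => ?_, fun x _ => ?_, vertex hΦ₁, vertex hΦ₂⟩
  · rw [second_deriv hΦ₁, hΦ₁, hΦ₂]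
    linear_combination -c₁ * φ x ^ 3 * hsum₁
  · rw [second_deriv hΦ₂, hΦ₁, hΦ₂]
    linear_combination -c₂ * φ x ^ 3 * hsum₂
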